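/- Let 𝔤 be a Lie algebra over a commutative ring R. The kernel functor Ker : Pt_𝔤(Lie_R) → Lie_R, sending a split extension (p : 𝔞 → 𝔤, s) to ker p, has a right adjoint. Consequently, the change-of-base functor along any Lie algebra morphism q : 𝔢 → 𝔤 between categories of points has a right adjoint (Lie_R is locally algebraically cartesian closed). -/

import Mathlib

open CategoryTheory

universe u

variable (R : Type u) [CommRing R]

/-- The category of points over `𝔤`: split epimorphisms onto `𝔤` with chosen section. -/
structure LiePt (L : Type u) [LieRing L] [LieAlgebra R L] where
  carrier : Type u
  [lieRing : LieRing carrier]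
  [lieAlg : LieAlgebra R carrier]
  p : carrier →ₗ⁅R⁆ L
  s : L →ₗ⁅R⁆ carrier
  split : ∀ x : L, p (s x) = x

attribute [instance] LiePt.lieRing LiePt.lieAlg

variable (L : Type u) [LieRing L] [LieAlgebra R L]

instance : Category (LiePt R L) where
  Hom X Y := {f : X.carrier →ₗ⁅R⁆ Y.carrier //
    (∀ a : X.carrier, Y.p (f a) = X.p a) ∧ (∀ x : L, f (X.s x) = Y.s x)}
  id X := ⟨LieHom.id, ⟨fun _ => rfl, fun _ => rfl⟩⟩
  comp {X Y Z} f g := ⟨g.1.comp f.1,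
    ⟨fun a => by rw [LieHom.comp_apply, g.2.1, f.2.1],
     fun x => by rw [LieHom.comp_apply, f.2.2, g.2.2]⟩⟩
  id_comp f := Subtype.ext (LieHom.ext fun _ => rfl)
  comp_id f := Subtype.ext (LieHom.ext fun _ => rfl)
  assoc f g h := Subtype.ext (LieHom.ext fun _ => rfl)

/-- The category of Lie algebras over `R` (bundled). -/
structure LieAlgB where
  carrier : Type u
  [lieRing : LieRing carrier]
  [lieAlg : LieAlgebra R carrier]

attribute [instance] LieAlgB.lieRing LieAlgB.lieAlg

instance : Category (LieAlgB R) where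
  Hom X Y := X.carrier →ₗ⁅R⁆ Y.carrier
  id X := LieHom.id
  comp f g := g.comp f
  id_comp f := LieHom.ext fun _ => rfl
  comp_id f := LieHom.ext fun _ => rfl
  assoc f g h := LieHom.ext fun _ => rfl

section Prod

variable {A B : Type u} [LieRing A] [LieRing B] [LieAlgebra R A] [LieAlgebra R B]

instance prodLieRing : LieRing (A × B) where
  bracket p q := (⁅p.1, q.1⁆, ⁅p.2, q.2⁆)
  add_lie x y z := by
    refine Prod.ext ?_ ?_ <;> exact add_lie _ _ _
  lie_add x y z := by
    refine Prod.ext ?_ ?_ <;> exact lie_add _ _ _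
  lie_self x := by
    refine Prod.ext ?_ ?_ <;> exact lie_self _
  leibniz_lie x y z := by
    refine Prod.ext ?_ ?_ <;> exact leibniz_lie _ _ _

instance prodLieAlgebra : LieAlgebra R (A × B) where
  lie_smul t x y := by
    refine Prod.ext ?_ ?_ <;> exact lie_smul _ _ _

end Prod

/-- The pullback of a point `(𝔞, p, s)` along `q : 𝔢 → 𝔤`, as a Lie subalgebra of the
product `𝔢 × 𝔞`. -/
def pbSub {E : Type u} [LieRing E] [LieAlgebra R E] (q : E →ₗ⁅R⁆ L) (X : LiePt R L) :
    LieSubalgebra R (E × X.carrier) where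
  carrier := {a | q a.1 = X.p a.2}
  add_mem' := by
    intro a b ha hb
    simp only [Set.mem_setOf_eq] at *
    simp [ha, hb]
  zero_mem' := by simp
  smul_mem' := by
    intro c a ha
    simp only [Set.mem_setOf_eq] at *
    simp [ha]
  lie_mem' := by
    intro a b ha hb
    simp only [Set.mem_setOf_eq] at *
    show q ⁅a.1, b.1⁆ = X.p ⁅a.2, b.2⁆
    simp [ha, hb]

/-- First projection of the Lie algebra product, as a Lie algebra homomorphism. -/
def prodFstHom {E A : Type u} [LieRing E] [LieAlgebra R E] [LieRing A] [LieAlgebra R A] :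
    (E × A) →ₗ⁅R⁆ E :=
  { LinearMap.fst R E A with map_lie' := rfl }

/-- The pullback point over `𝔢` obtained by change of base along `q : 𝔢 → 𝔤`. -/
def pbPoint {E : Type u} [LieRing E] [LieAlgebra R E] (q : E →ₗ⁅R⁆ L) (X : LiePt R L) :
    LiePt R E where
  carrier := ↥(pbSub R L q X)
  p := (prodFstHom R).comp (pbSub R L q X).incl
  s :=
    { toFun := fun e => ⟨(e, X.s (q e)), (X.split (q e)).symm⟩
      map_add' := fun e e' => by
        apply Subtype.ext
        refine Prod.ext rfl ?_
        simp
      map_smul' := fun c e => by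
        apply Subtype.ext
        refine Prod.ext rfl ?_
        show X.s (q (c • e)) = c • X.s (q e)
        simp
      map_lie' := by
        intro e e'
        apply Subtype.ext
        refine Prod.ext rfl ?_
        show X.s (q ⁅e, e'⁆) = ⁅X.s (q e), X.s (q e')⁆
        simp }
  split := fun x => rfl

section Cofree

open UniversalEnvelopingAlgebra TensorProduct

attribute [local instance 100] LieRing.ofAssociativeRing

variable {R L} in
/-- The enveloping algebra is spanned by `1` and right multiples by generators. -/
theorem uea_induction {P : UniversalEnvelopingAlgebra R L → Prop} (one : P 1)
    (add : ∀ u v, P u → P v → P (u + v)) (smul : ∀ (c : R) u, P u → P (c • u))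
    (mul_ι : ∀ u x, P u → P (u * ι R x)) (u : UniversalEnvelopingAlgebra R L) : P u := by
  let T : Subalgebra R (UniversalEnvelopingAlgebra R L) :=
    { carrier := {a | ∀ v, P v → P (v * a)}
      mul_mem' := fun {a b} ha hb v hv => by rw [← mul_assoc]; exact hb _ (ha _ hv)
      add_mem' := fun {a b} ha hb v hv => by rw [mul_add]; exact add _ _ (ha _ hv) (hb _ hv)
      algebraMap_mem' := fun r v hv => by
        rw [← Algebra.commutes, ← Algebra.smul_def]; exact smul r v hv }
  let f : L →ₗ⁅R⁆ T :=
    { toFun := fun x => ⟨ι R x, fun v hv => mul_ι v x hv⟩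
      map_add' := fun x y => Subtype.ext (map_add (ι R) x y)
      map_smul' := fun c x => Subtype.ext (map_smul (ι R) c x)
      map_lie' := fun {x y} => Subtype.ext (LieHom.map_lie (ι R) x y) }
  have h : T.val.comp (lift R f) = AlgHom.id R _ := by
    apply hom_ext
    ext x
    show ((lift R f (ι R x) : T) : UniversalEnvelopingAlgebra R L) = ι R x
    rw [lift_ι_apply]
    rfl
  have hu : u ∈ T := by
    have := DFunLike.congr_fun h u
    rw [show u = ((lift R f u : T) : UniversalEnvelopingAlgebra R L) from this.symm]
    exact (lift R f u).2
  simpa using hu 1 one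

/-- The comultiplication of the enveloping algebra. -/
noncomputable def ueaComul :
    UniversalEnvelopingAlgebra R L →ₐ[R]
      UniversalEnvelopingAlgebra R L ⊗[R] UniversalEnvelopingAlgebra R L :=
  lift R
    { toFun := fun x => ι R x ⊗ₜ 1 + 1 ⊗ₜ ι R x
      map_add' := fun x y => by
        rw [map_add, add_tmul, tmul_add]; abel
      map_smul' := fun c x => by
        rw [map_smul, tmul_smul, ← smul_tmul', smul_add]; rfl
      map_lie' := fun {x y} => by
        simp only [LieHom.map_lie, LieRing.of_associative_ring_bracket, mul_add, add_mul,
          Algebra.TensorProduct.tmul_mul_tmul, one_mul, mul_one, sub_tmul, tmul_sub]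
        abel }

/-- The Lie algebra of linear maps from the enveloping algebra of `L` to `N` under convolution:
the cofree Lie algebra with `L`-action on `N`. -/
def CofreeLie (N : Type u) [LieRing N] [LieAlgebra R N] : Type u :=
  UniversalEnvelopingAlgebra R L →ₗ[R] N

namespace CofreeLie

variable {R L} {N : Type u} [LieRing N] [LieAlgebra R N]

noncomputable instance : AddCommGroup (CofreeLie R L N) :=
  inferInstanceAs (AddCommGroup (UniversalEnvelopingAlgebra R L →ₗ[R] N))

noncomputable instance : Module R (CofreeLie R L N) :=
  inferInstanceAs (Module R (UniversalEnvelopingAlgebra R L →ₗ[R] N))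

instance : FunLike (CofreeLie R L N) (UniversalEnvelopingAlgebra R L) N :=
  inferInstanceAs (FunLike (UniversalEnvelopingAlgebra R L →ₗ[R] N) _ _)

instance : LinearMapClass (CofreeLie R L N) R (UniversalEnvelopingAlgebra R L) N :=
  inferInstanceAs (LinearMapClass (UniversalEnvelopingAlgebra R L →ₗ[R] N) R _ _)

@[simp] theorem add_apply (f g : CofreeLie R L N) (u : UniversalEnvelopingAlgebra R L) :
    (f + g) u = f u + g u := rfl

@[simp] theorem sub_apply (f g : CofreeLie R L N) (u : UniversalEnvelopingAlgebra R L) :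
    (f - g) u = f u - g u := rfl

@[simp] theorem smul_apply (c : R) (f : CofreeLie R L N) (u : UniversalEnvelopingAlgebra R L) :
    (c • f) u = c • f u := rfl

@[simp] theorem zero_apply (u : UniversalEnvelopingAlgebra R L) :
    (0 : CofreeLie R L N) u = 0 := rfl

@[ext] theorem ext {f g : CofreeLie R L N} (h : ∀ u, f u = g u) : f = g := DFunLike.ext _ _ h

/-- Right translation by elements of `L`. -/
noncomputable def act (x : L) : CofreeLie R L N →ₗ[R] CofreeLie R L N where
  toFun f := LinearMap.comp (f : UniversalEnvelopingAlgebra R L →ₗ[R] N)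
    (LinearMap.mulRight R (ι R x))
  map_add' _ _ := rfl
  map_smul' _ _ := rfl

@[simp] theorem act_apply (x : L) (f : CofreeLie R L N) (u : UniversalEnvelopingAlgebra R L) :
    act x f u = f (u * ι R x) := rfl

/-- The map `u ⊗ v ↦ ⁅f u, g v⁆`. -/
noncomputable def pairing (f g : CofreeLie R L N) :
    UniversalEnvelopingAlgebra R L ⊗[R] UniversalEnvelopingAlgebra R L →ₗ[R] N :=
  TensorProduct.lift (LinearMap.mk₂ R (fun u v => ⁅f u, g v⁆)
    (fun _ _ _ => by simp) (fun _ _ _ => by simp) (fun _ _ _ => by simp) (fun _ _ _ => by simp))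

@[simp] theorem pairing_tmul (f g : CofreeLie R L N) (u v : UniversalEnvelopingAlgebra R L) :
    pairing f g (u ⊗ₜ v) = ⁅f u, g v⁆ := rfl

noncomputable instance : Bracket (CofreeLie R L N) (CofreeLie R L N) where
  bracket f g := pairing f g ∘ₗ (ueaComul R L).toLinearMap

theorem lie_apply (f g : CofreeLie R L N) (u : UniversalEnvelopingAlgebra R L) :
    ⁅f, g⁆ u = pairing f g (ueaComul R L u) := rfl

@[simp] theorem lie_apply_one (f g : CofreeLie R L N) : ⁅f, g⁆ 1 = ⁅f 1, g 1⁆ := by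
  rw [lie_apply, map_one, Algebra.TensorProduct.one_def, pairing_tmul]

theorem lie_apply_mul_ι (f g : CofreeLie R L N) (u : UniversalEnvelopingAlgebra R L) (x : L) :
    ⁅f, g⁆ (u * ι R x) = ⁅act x f, g⁆ u + ⁅f, act x g⁆ u := by
  simp only [lie_apply, map_mul]
  rw [show ueaComul R L (ι R x) = ι R x ⊗ₜ 1 + 1 ⊗ₜ ι R x from lift_ι_apply R _ x]
  induction ueaComul R L u using TensorProduct.induction_on with
  | zero => simp
  | tmul a b => simp [mul_add]
  | add s t hs ht =>
    rw [add_mul, map_add, hs, ht, map_add, map_add]; abel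

theorem act_lie (x : L) (f g : CofreeLie R L N) : act x ⁅f, g⁆ = ⁅act x f, g⁆ + ⁅f, act x g⁆ := by
  ext u; rw [act_apply, lie_apply_mul_ι, add_apply]

protected theorem add_lie (f g h : CofreeLie R L N) : ⁅f + g, h⁆ = ⁅f, h⁆ + ⁅g, h⁆ := by
  ext u
  simp only [lie_apply, add_apply]
  induction ueaComul R L u using TensorProduct.induction_on with
  | zero => simp
  | tmul a b => simp
  | add s t hs ht => rw [map_add, hs, ht, map_add, map_add]; abel

protected theorem lie_add (f g h : CofreeLie R L N) : ⁅f, g + h⁆ = ⁅f, g⁆ + ⁅f, h⁆ := by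
  ext u
  simp only [lie_apply, add_apply]
  induction ueaComul R L u using TensorProduct.induction_on with
  | zero => simp
  | tmul a b => simp
  | add s t hs ht => rw [map_add, hs, ht, map_add, map_add]; abel

protected theorem lie_smul (c : R) (f g : CofreeLie R L N) : ⁅f, c • g⁆ = c • ⁅f, g⁆ := by
  ext u
  simp only [lie_apply, smul_apply]
  induction ueaComul R L u using TensorProduct.induction_on with
  | zero => simp
  | tmul a b => simp
  | add s t hs ht => rw [map_add, hs, ht, map_add, smul_add]

protected theorem lie_skew (f g : CofreeLie R L N) (u : UniversalEnvelopingAlgebra R L) :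
    ⁅f, g⁆ u = -⁅g, f⁆ u := by
  induction u using uea_induction generalizing f g with
  | one => simp
  | add u v hu hv => rw [map_add, map_add, hu, hv, neg_add]
  | smul c u hu => rw [map_smul, map_smul, hu, smul_neg]
  | mul_ι u x hu =>
    rw [lie_apply_mul_ι, lie_apply_mul_ι, hu, hu f, neg_add, add_comm]

protected theorem lie_self (f : CofreeLie R L N) : ⁅f, f⁆ = 0 := by
  ext u
  induction u using uea_induction with
  | one => simp
  | add u v hu hv => simp_all
  | smul c u hu => simp_all
  | mul_ι u x hu =>
    rw [lie_apply_mul_ι, CofreeLie.lie_skew, neg_add_cancel, zero_apply]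

protected theorem leibniz_lie (f g h : CofreeLie R L N) :
    ⁅f, ⁅g, h⁆⁆ = ⁅⁅f, g⁆, h⁆ + ⁅g, ⁅f, h⁆⁆ := by
  ext u
  induction u using uea_induction generalizing f g h with
  | one => simp
  | add u v hu hv =>
    rw [map_add, map_add, hu, hv]
  | smul c u hu => rw [map_smul, map_smul, hu]
  | mul_ι u x hu =>
    simp only [add_apply, lie_apply_mul_ι, act_lie, CofreeLie.add_lie, CofreeLie.lie_add]
    rw [hu, hu f, hu f]
    simp only [add_apply]
    abel

noncomputable instance : LieRing (CofreeLie R L N) where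
  add_lie := CofreeLie.add_lie
  lie_add := CofreeLie.lie_add
  lie_self := CofreeLie.lie_self
  leibniz_lie := CofreeLie.leibniz_lie

noncomputable instance : LieAlgebra R (CofreeLie R L N) where
  lie_smul := CofreeLie.lie_smul

theorem act_lie_left (x y : L) (f : CofreeLie R L N) :
    act ⁅x, y⁆ f = act x (act y f) - act y (act x f) := by
  ext u
  simp only [act_apply, sub_apply, LieHom.map_lie, LieRing.of_associative_ring_bracket, mul_sub,
    map_sub, mul_assoc]

end CofreeLie

section Coinduction

variable {R L} {E : Type u} [LieRing E] [LieAlgebra R E]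

/-- A function is coinduced along `q : E → L` from a point over `E` if it is equivariant with
values in the kernel of the point. -/
def IsCoinduced (q : E →ₗ⁅R⁆ L) (Y : LiePt R E) (f : CofreeLie R L Y.carrier) : Prop :=
  (∀ u, Y.p (f u) = 0) ∧ ∀ e u, f (ι R (q e) * u) = ⁅Y.s e, f u⁆

theorem IsCoinduced.act {q : E →ₗ⁅R⁆ L} {Y : LiePt R E} {f : CofreeLie R L Y.carrier}
    (hf : IsCoinduced q Y f) (x : L) : IsCoinduced q Y (CofreeLie.act x f) :=
  ⟨fun _ => hf.1 _, fun e u => by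
    rw [CofreeLie.act_apply, CofreeLie.act_apply, mul_assoc, hf.2]⟩

/-- The Lie algebra coinduced along `q : E → L` from the kernel of a point over `E`. -/
noncomputable def coindSub (q : E →ₗ⁅R⁆ L) (Y : LiePt R E) :
    LieSubalgebra R (CofreeLie R L Y.carrier) where
  carrier := {f | IsCoinduced q Y f}
  add_mem' := fun hf hg =>
    ⟨fun u => by rw [CofreeLie.add_apply, map_add, hf.1, hg.1, add_zero],
      fun e u => by simp only [CofreeLie.add_apply, hf.2, hg.2, lie_add]⟩
  zero_mem' := ⟨fun _ => by simp, fun _ _ => by simp⟩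
  smul_mem' := fun c f hf =>
    ⟨fun u => by rw [CofreeLie.smul_apply, map_smul, hf.1, smul_zero],
      fun e u => by simp only [CofreeLie.smul_apply, hf.2, lie_smul]⟩
  lie_mem' := by
    intro f g (hf : IsCoinduced q Y f) (hg : IsCoinduced q Y g)
    refine ⟨fun u => ?_, fun e u => ?_⟩
    · induction u using uea_induction generalizing f g with
      | one => rw [CofreeLie.lie_apply_one, LieHom.map_lie, hf.1, zero_lie]
      | add u v hu hv => rw [map_add, map_add, hu hf hg, hv hf hg, add_zero]
      | smul c u hu => rw [map_smul, map_smul, hu hf hg, smul_zero]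
      | mul_ι u x hu =>
        rw [CofreeLie.lie_apply_mul_ι, map_add, hu (hf.act x) hg, hu hf (hg.act x),
          add_zero]
    · induction u using uea_induction generalizing f g with
      | one =>
        have hf' := hf.2 e 1
        have hg' := hg.2 e 1
        rw [mul_one] at hf' hg'
        rw [mul_one, ← one_mul (ι R (q e)), CofreeLie.lie_apply_mul_ι, CofreeLie.lie_apply_one,
          CofreeLie.lie_apply_one, CofreeLie.lie_apply_one, CofreeLie.act_apply,
          CofreeLie.act_apply, one_mul, hf', hg']
        exact (leibniz_lie _ _ _).symm
      | add u v hu hv => rw [mul_add, map_add, map_add, hu hf hg, hv hf hg, lie_add]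
      | smul c u hu => rw [mul_smul_comm, map_smul, map_smul, hu hf hg, lie_smul]
      | mul_ι u x hu =>
        rw [← mul_assoc, CofreeLie.lie_apply_mul_ι, CofreeLie.lie_apply_mul_ι,
          hu (hf.act x) hg, hu hf (hg.act x), lie_add]

/-- The derivation of the coinduced Lie algebra given by an element of `L`. -/
noncomputable def coindDer (q : E →ₗ⁅R⁆ L) (Y : LiePt R E) (x : L) :
    LieDerivation R (coindSub q Y) (coindSub q Y) where
  toLinearMap :=
    { toFun := fun f => ⟨CofreeLie.act x f.1, IsCoinduced.act f.2 x⟩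
      map_add' := fun _ _ => rfl
      map_smul' := fun _ _ => rfl }
  leibniz' f g := Subtype.ext <| (CofreeLie.act_lie x f.1 g.1).trans <| by
    rw [← lie_skew, neg_add_eq_sub]
    rfl

/-- The action of `L` on the coinduced Lie algebra by derivations. -/
noncomputable def coindAct (q : E →ₗ⁅R⁆ L) (Y : LiePt R E) :
    L →ₗ⁅R⁆ LieDerivation R (coindSub q Y) (coindSub q Y) where
  toFun := coindDer q Y
  map_add' x y := LieDerivation.ext fun f => Subtype.ext <| CofreeLie.ext fun u => by
    show f.1 (u * ι R (x + y)) = f.1 (u * ι R x) + f.1 (u * ι R y)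
    rw [map_add, mul_add, map_add]
  map_smul' c x := LieDerivation.ext fun f => Subtype.ext <| CofreeLie.ext fun u => by
    show f.1 (u * ι R (c • x)) = c • f.1 (u * ι R x)
    rw [map_smul, mul_smul_comm, map_smul]
  map_lie' {x y} := LieDerivation.ext fun f => Subtype.ext <|
    (CofreeLie.act_lie_left x y f.1).trans <| by
      rw [LieDerivation.commutator_apply]
      rfl

/-- The point over `L` coinduced along `q : E → L` from a point over `E`. -/
noncomputable def coindPoint (q : E →ₗ⁅R⁆ L) (Y : LiePt R E) : LiePt R L where
  carrier := coindSub q Y ⋊⁅coindAct q Y⁆ L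
  p := LieAlgebra.SemiDirectSum.projr _
  s := LieAlgebra.SemiDirectSum.inr _
  split := fun _ => rfl

/-- The action of the enveloping algebra of `L` on the kernel of a point over `L`. -/
noncomputable def kerAct (X : LiePt R L) :
    UniversalEnvelopingAlgebra R L →ₐ[R] Module.End R X.p.ker :=
  lift R ((LieModule.toEnd R X.carrier X.p.ker).comp X.s)

theorem kerAct_ι (X : LiePt R L) (x : L) (k : X.p.ker) : kerAct X (ι R x) k = ⁅X.s x, k⁆ := by
  rw [kerAct, lift_ι_apply]; rfl

section Transpose

variable {N : Type u} [LieRing N] [LieAlgebra R N] (X : LiePt R L) (φ : X.p.ker →ₗ⁅R⁆ N)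

/-- The transpose `k ↦ (u ↦ φ (u • k))` of a morphism out of the kernel of a point. -/
noncomputable def kerTranspose : X.p.ker →ₗ[R] CofreeLie R L N where
  toFun k := (φ : X.p.ker →ₗ[R] N) ∘ₗ (kerAct X).toLinearMap.flip k
  map_add' k l := CofreeLie.ext fun u => by
    show φ (kerAct X u (k + l)) = φ (kerAct X u k) + φ (kerAct X u l)
    rw [map_add, map_add]
  map_smul' c k := CofreeLie.ext fun u => by
    show φ (kerAct X u (c • k)) = c • φ (kerAct X u k)
    rw [map_smul, map_smul]

theorem kerTranspose_apply (k : X.p.ker) (u : UniversalEnvelopingAlgebra R L) :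
    kerTranspose X φ k u = φ (kerAct X u k) := rfl

theorem kerTranspose_apply_one (k : X.p.ker) : kerTranspose X φ k 1 = φ k := by
  rw [kerTranspose_apply, map_one, Module.End.one_apply]

theorem kerTranspose_section_lie (x : L) (k : X.p.ker) :
    kerTranspose X φ ⁅X.s x, k⁆ = CofreeLie.act x (kerTranspose X φ k) := by
  ext u
  rw [CofreeLie.act_apply, kerTranspose_apply, kerTranspose_apply, map_mul, Module.End.mul_apply,
    kerAct_ι]

theorem kerTranspose_lie (k l : X.p.ker) :
    kerTranspose X φ ⁅k, l⁆ = ⁅kerTranspose X φ k, kerTranspose X φ l⁆ := by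
  ext u
  induction u using uea_induction generalizing k l with
  | one =>
    rw [CofreeLie.lie_apply_one, kerTranspose_apply_one, kerTranspose_apply_one,
      kerTranspose_apply_one, LieHom.map_lie]
  | add u v hu hv => rw [map_add, map_add, hu, hv]
  | smul c u hu => rw [map_smul, map_smul, hu]
  | mul_ι u x hu =>
    rw [CofreeLie.lie_apply_mul_ι, ← CofreeLie.act_apply, ← kerTranspose_section_lie,
      ← kerTranspose_section_lie, ← kerTranspose_section_lie, ← hu, ← hu, ← CofreeLie.add_apply,
      ← map_add]
    congr 2
    exact Subtype.ext (leibniz_lie (X.s x) (k : X.carrier) (l : X.carrier))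

end Transpose

/-- The projection of a point onto its kernel along the section. -/
def kerProj (X : LiePt R L) : X.carrier →ₗ[R] X.p.ker where
  toFun a := ⟨a - X.s (X.p a), by rw [LieHom.mem_ker, map_sub, X.split, sub_self]⟩
  map_add' a b := Subtype.ext <| by
    show a + b - X.s (X.p (a + b)) = a - X.s (X.p a) + (b - X.s (X.p b))
    rw [map_add, map_add]; abel
  map_smul' c a := Subtype.ext <| by
    show c • a - X.s (X.p (c • a)) = c • (a - X.s (X.p a))
    rw [map_smul, map_smul, smul_sub]

theorem kerProj_lie (X : LiePt R L) (a b : X.carrier) :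
    kerProj X ⁅a, b⁆ = ⁅kerProj X a, kerProj X b⁆ + ⁅X.s (X.p a), kerProj X b⁆ -
      ⁅X.s (X.p b), kerProj X a⁆ := Subtype.ext <| by
  show ⁅a, b⁆ - X.s (X.p ⁅a, b⁆) = ⁅a - X.s (X.p a), b - X.s (X.p b)⁆ +
    ⁅X.s (X.p a), b - X.s (X.p b)⁆ - ⁅X.s (X.p b), a - X.s (X.p a)⁆
  rw [← lie_skew (X.s (X.p b)) (a - X.s (X.p a))]
  simp only [LieHom.map_lie, lie_sub, sub_lie]
  abel

theorem kerProj_coe (X : LiePt R L) (k : X.p.ker) : kerProj X k = k := Subtype.ext <| by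
  show (k : X.carrier) - X.s (X.p k) = k
  rw [LieHom.mem_ker.1 k.2, map_zero, sub_zero]

theorem kerProj_section (X : LiePt R L) (x : L) : kerProj X (X.s x) = 0 := Subtype.ext <| by
  show X.s x - X.s (X.p (X.s x)) = 0
  rw [X.split, sub_self]

/-- The universal property of the coinduced point: a morphism from the kernel of `X` to the
kernel of `Y` which is equivariant along `q` extends uniquely to a morphism of points. -/
theorem existsUnique_hom_coindPoint (q : E →ₗ⁅R⁆ L) (Y : LiePt R E) (X : LiePt R L)
    (φ : X.p.ker →ₗ⁅R⁆ Y.carrier) (hp : ∀ k, Y.p (φ k) = 0)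
    (hs : ∀ e k, φ ⁅X.s (q e), k⁆ = ⁅Y.s e, φ k⁆) :
    ∃! g : X ⟶ coindPoint q Y,
      ∀ k : X.p.ker, (g.1 (k : X.carrier)).left.1 1 = φ k := by
  have hmem : ∀ k, kerTranspose X φ k ∈ coindSub q Y := fun k =>
    ⟨fun u => hp _, fun e u => by
      rw [kerTranspose_apply, map_mul, Module.End.mul_apply, kerAct_ι, hs, kerTranspose_apply]⟩
  let g : X.carrier →ₗ⁅R⁆ (coindPoint q Y).carrier :=
    { toFun := fun a => ⟨⟨kerTranspose X φ (kerProj X a), hmem _⟩, X.p a⟩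
      map_add' := fun a b => LieAlgebra.SemiDirectSum.ext
        (Subtype.ext (by
          show kerTranspose X φ (kerProj X (a + b)) =
            kerTranspose X φ (kerProj X a) + kerTranspose X φ (kerProj X b)
          rw [map_add, map_add])) (map_add X.p a b)
      map_smul' := fun c a => LieAlgebra.SemiDirectSum.ext
        (Subtype.ext (by
          show kerTranspose X φ (kerProj X (c • a)) = c • kerTranspose X φ (kerProj X a)
          rw [map_smul, map_smul])) (map_smul X.p c a)
      map_lie' := fun {a b} => LieAlgebra.SemiDirectSum.ext
        (Subtype.ext (by
          show kerTranspose X φ (kerProj X ⁅a, b⁆) =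
            ⁅kerTranspose X φ (kerProj X a), kerTranspose X φ (kerProj X b)⁆ +
              CofreeLie.act (X.p a) (kerTranspose X φ (kerProj X b)) -
              CofreeLie.act (X.p b) (kerTranspose X φ (kerProj X a))
          rw [kerProj_lie, map_sub, map_add, kerTranspose_lie, kerTranspose_section_lie,
            kerTranspose_section_lie])) (LieHom.map_lie X.p a b) }
  refine ⟨⟨g, fun a => rfl, fun x => LieAlgebra.SemiDirectSum.ext (Subtype.ext ?_) (X.split x)⟩,
    fun k => ?_, fun h hh => Subtype.ext <| LieHom.ext fun a => ?_⟩
  · show kerTranspose X φ (kerProj X (X.s x)) = 0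
    rw [kerProj_section, map_zero]
  · show kerTranspose X φ (kerProj X k) 1 = φ k
    rw [kerProj_coe, kerTranspose_apply_one]
  · have hright : ∀ b, (h.1 b).right = X.p b := h.2.1
    have hsec : ∀ (x : L) (k : X.p.ker),
        (h.1 ⁅X.s x, (k : X.carrier)⁆).left.1 = CofreeLie.act x (h.1 (k : X.carrier)).left.1 := by
      intro x k
      have hk : (h.1 (k : X.carrier)).right = 0 := (hright k).trans k.2
      rw [LieHom.map_lie, h.2.2]
      show ⁅(0 : CofreeLie R L Y.carrier), (h.1 (k : X.carrier)).left.1⁆ +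
        CofreeLie.act x (h.1 (k : X.carrier)).left.1 -
          CofreeLie.act (h.1 (k : X.carrier)).right 0 = _
      rw [zero_lie, zero_add, map_zero, sub_zero]
    have hleft : ∀ (u : UniversalEnvelopingAlgebra R L) (k : X.p.ker),
        (h.1 (k : X.carrier)).left.1 u = kerTranspose X φ k u := by
      intro u
      induction u using uea_induction with
      | one => intro k; rw [hh, kerTranspose_apply_one]
      | add u v hu hv => intro k; rw [map_add, map_add, hu, hv]
      | smul c u hu => intro k; rw [map_smul, map_smul, hu]
      | mul_ι u x hu =>
        intro k
        rw [← CofreeLie.act_apply, ← CofreeLie.act_apply, ← hsec, ← kerTranspose_section_lie]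
        exact hu ⁅X.s x, k⁆
    refine LieAlgebra.SemiDirectSum.ext (Subtype.ext (CofreeLie.ext fun u => ?_)) (hright a)
    show _ = kerTranspose X φ (kerProj X a) u
    rw [← hleft]
    have ha : h.1 a = h.1 ((kerProj X a : X.p.ker) : X.carrier) + h.1 (X.s (X.p a)) := by
      rw [← map_add]; congr 1; exact (sub_add_cancel _ _).symm
    rw [ha, h.2.2]
    show (h.1 (kerProj X a : X.carrier)).left.1 u + 0 = _
    rw [add_zero]

end Coinduction

end Cofree

section Functors

/-- A functor with a universal arrow to every object has a right adjoint. -/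
theorem isLeftAdjoint_of_universal {C D : Type*} [Category C] [Category D] (F : C ⥤ D)
    (h : ∀ Y : D, ∃ (G : C) (ε : F.obj G ⟶ Y), ∀ (X : C) (f : F.obj X ⟶ Y),
      ∃! g : X ⟶ G, F.map g ≫ ε = f) : F.IsLeftAdjoint := by
  have (Y : D) : Limits.HasTerminal (CostructuredArrow F Y) := by
    obtain ⟨G, ε, hε⟩ := h Y
    refine (Limits.IsTerminal.ofUniqueHom (Y := CostructuredArrow.mk ε)
      (fun A => CostructuredArrow.homMk (hε A.left A.hom).choose
        (hε A.left A.hom).choose_spec.1) fun A m => ?_).hasTerminal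
    ext
    exact (hε A.left A.hom).choose_spec.2 _ (CostructuredArrow.w m)
  exact isLeftAdjoint_of_costructuredArrowTerminals F

/-- The kernel functor on points over `L`. -/
def kerFunctor : LiePt R L ⥤ LieAlgB R where
  obj X := { carrier := ↥(X.p.ker) }
  map f :=
    { toFun := fun k => ⟨f.1 k, (f.2.1 k).trans k.2⟩
      map_add' := fun k l => Subtype.ext (map_add f.1 k.1 l.1)
      map_smul' := fun c k => Subtype.ext (map_smul f.1 c k.1)
      map_lie' := fun {k l} => Subtype.ext (LieHom.map_lie f.1 k.1 l.1) }
  map_id _ := rfl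
  map_comp _ _ := rfl

/-- The functor of change of base along `q`. -/
def pbFunctor {E : Type u} [LieRing E] [LieAlgebra R E] (q : E →ₗ⁅R⁆ L) :
    LiePt R L ⥤ LiePt R E where
  obj X := pbPoint R L q X
  map f :=
    ⟨{ toFun := fun a => ⟨(a.1.1, f.1 a.1.2), a.2.trans (f.2.1 _).symm⟩
       map_add' := fun a b => Subtype.ext (Prod.ext rfl (map_add f.1 a.1.2 b.1.2))
       map_smul' := fun c a => Subtype.ext (Prod.ext rfl (map_smul f.1 c a.1.2))
       map_lie' := fun {a b} => Subtype.ext (Prod.ext rfl (LieHom.map_lie f.1 a.1.2 b.1.2)) },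
      fun _ => rfl, fun e => Subtype.ext (Prod.ext rfl (f.2.2 (q e)))⟩
  map_id _ := rfl
  map_comp _ _ := rfl

/-- A Lie algebra as a point over the zero Lie algebra. -/
def pointOverBot (M : LieAlgB R) : LiePt R (⊥ : LieSubalgebra R L) where
  carrier := M.carrier
  p := 0
  s := 0
  split x := Subtype.ext (LieSubalgebra.mem_bot x.1 |>.1 x.2).symm

theorem kerFunctor_isLeftAdjoint : (kerFunctor R L).IsLeftAdjoint := by
  refine isLeftAdjoint_of_universal _ fun M => ?_
  let q := (⊥ : LieSubalgebra R L).incl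
  let ε : (kerFunctor R L).obj (coindPoint q (pointOverBot R L M)) ⟶ M :=
    { toFun := fun k => k.1.left.1 1
      map_add' := fun _ _ => rfl
      map_smul' := fun _ _ => rfl
      map_lie' := fun {k l} => by
        have hk : k.1.right = 0 := k.2
        have hl : l.1.right = 0 := l.2
        show (⁅k.1.left, l.1.left⁆ + coindAct q _ k.1.right l.1.left -
          coindAct q _ l.1.right k.1.left).1 1 = _
        rw [hk, hl, map_zero, LieDerivation.zero_apply, LieDerivation.zero_apply, add_zero,
          sub_zero]
        exact CofreeLie.lie_apply_one _ _ }
  refine ⟨_, ε, fun X (φ : X.p.ker →ₗ⁅R⁆ M.carrier) => ?_⟩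
  obtain ⟨g, hg, hu⟩ := existsUnique_hom_coindPoint q (pointOverBot R L M) X φ
    (fun _ => rfl) (fun e k => by
      have hk : ⁅X.s (q e), k⁆ = 0 := by
        rw [show q e = 0 from (LieSubalgebra.mem_bot e.1).1 e.2, map_zero, zero_lie]
      rw [hk]
      exact (map_zero φ).trans (zero_lie (L := M.carrier) (φ k)).symm)
  exact ⟨g, LieHom.ext hg, fun h hh => hu h (LieHom.congr_fun hh)⟩

theorem pbFunctor_isLeftAdjoint {E : Type u} [LieRing E] [LieAlgebra R E] (q : E →ₗ⁅R⁆ L) :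
    (pbFunctor R L q).IsLeftAdjoint := by
  refine isLeftAdjoint_of_universal _ fun Y => ?_
  let ε : (pbFunctor R L q).obj (coindPoint q Y) ⟶ Y :=
    ⟨{ toFun := fun a => a.1.2.left.1 1 + Y.s a.1.1
       map_add' := fun a b => by
         show a.1.2.left.1 1 + b.1.2.left.1 1 + Y.s (a.1.1 + b.1.1) = _
         rw [map_add]; abel
       map_smul' := fun c a => by
         show c • a.1.2.left.1 1 + Y.s (c • a.1.1) = c • (a.1.2.left.1 1 + Y.s a.1.1)
         rw [map_smul, smul_add]
       map_lie' := fun {a b} => by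
         have ha : q a.1.1 = a.1.2.right := a.2
         have hb : q b.1.1 = b.1.2.right := b.2
         have key : ∀ (e : E) (f : coindSub q Y), f.1 (1 * UniversalEnvelopingAlgebra.ι R (q e)) = ⁅Y.s e, f.1 1⁆ :=
           fun e f => by rw [one_mul, ← f.2.2, mul_one]
         show ⁅a.1.2.left.1, b.1.2.left.1⁆ 1 + b.1.2.left.1 (1 * UniversalEnvelopingAlgebra.ι R a.1.2.right) -
           a.1.2.left.1 (1 * UniversalEnvelopingAlgebra.ι R b.1.2.right) + Y.s ⁅a.1.1, b.1.1⁆ =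
             ⁅a.1.2.left.1 1 + Y.s a.1.1, b.1.2.left.1 1 + Y.s b.1.1⁆
         rw [← ha, ← hb, key, key, CofreeLie.lie_apply_one, LieHom.map_lie,
           ← lie_skew (Y.s b.1.1) (a.1.2.left.1 1), lie_add, add_lie, add_lie]
         abel },
      fun a => by
        show Y.p (a.1.2.left.1 1 + Y.s a.1.1) = a.1.1
        rw [map_add, a.1.2.left.2.1, Y.split, zero_add],
      fun e => zero_add (Y.s e)⟩
  refine ⟨_, ε, fun X (φ : pbPoint R L q X ⟶ Y) => ?_⟩
  let i : X.p.ker →ₗ⁅R⁆ (pbPoint R L q X).carrier :=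
    { toFun := fun k => ⟨(0, k.1), (map_zero q).trans k.2.symm⟩
      map_add' := fun k l => Subtype.ext (Prod.ext (add_zero 0).symm rfl)
      map_smul' := fun c k => Subtype.ext (Prod.ext (smul_zero c).symm rfl)
      map_lie' := fun {k l} => Subtype.ext (Prod.ext (lie_zero 0).symm rfl) }
  obtain ⟨g, hg, hu⟩ := existsUnique_hom_coindPoint q Y X (φ.1.comp i)
    (fun k => φ.2.1 (i k)) (fun e k => by
      show φ.1 (i ⁅X.s (q e), k⁆) = ⁅Y.s e, φ.1 (i k)⁆
      rw [← φ.2.2, ← LieHom.map_lie]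
      exact congrArg φ.1 (Subtype.ext (Prod.ext (lie_zero e).symm rfl)))
  let ψ : pbPoint R L q X ⟶ Y := (pbFunctor R L q).map g ≫ ε
  refine ⟨g, Subtype.ext (LieHom.ext fun (a : pbSub R L q X) => ?_), fun h hh => hu h fun k => ?_⟩
  · have ha : q a.1.1 = X.p a.1.2 := a.2
    have hd : a = i (kerProj X a.1.2) + (pbPoint R L q X).s a.1.1 :=
      Subtype.ext (Prod.ext (zero_add _).symm (by
        show a.1.2 = a.1.2 - X.s (X.p a.1.2) + X.s (q a.1.1)
        rw [ha, sub_add_cancel]))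
    show ψ.1 a = φ.1 a
    rw [hd, map_add, map_add, ψ.2.2, φ.2.2]
    congr 1
    show (g.1 (kerProj X a.1.2 : X.carrier)).left.1 1 + Y.s 0 = _
    rw [hg, map_zero, add_zero]
    rfl
  · have := LieHom.congr_fun (congrArg Subtype.val hh) (i k)
    refine Eq.trans ?_ this
    show _ = (h.1 (k : X.carrier)).left.1 1 + Y.s 0
    rw [map_zero, add_zero]

end Functors

/-- The kernel functor `Ker : Pt_𝔤(Lie_R) → Lie_R` has a right adjoint, and
consequently the change-of-base functor along any morphism `q : 𝔢 → 𝔤` (given by pullback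
of points) has a right adjoint: `Lie_R` is locally algebraically cartesian closed. -/
theorem statement18 :
    (∃ Ker : LiePt R L ⥤ LieAlgB R,
      (∀ X : LiePt R L, Ker.obj X = { carrier := ↥(X.p.ker) }) ∧ Ker.IsLeftAdjoint) ∧
    (∀ (E : Type u) (_ : LieRing E) (_ : LieAlgebra R E) (q : E →ₗ⁅R⁆ L),
      ∃ pb : LiePt R L ⥤ LiePt R E,
        (∀ X : LiePt R L, pb.obj X = pbPoint R L q X) ∧ pb.IsLeftAdjoint) := by
  exact ⟨⟨kerFunctor R L, fun _ => rfl, kerFunctor_isLeftAdjoint R L⟩, fun E _ _ q =>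
    ⟨pbFunctor R L q, fun _ => rfl, pbFunctor_isLeftAdjoint R L q⟩⟩
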